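/- arXiv:math/0403330 — 2 statements merged into one kernel-verified Lean document; each statement's English description precedes it below -/
import Mathlib

section
/- Let x ∈ J have rank r−1, written x = Σ_{j=1}^{r−1} λ_j c_j with (c₁,…,c_r) a Jordan frame and λ_j ≠ 0 for 1 ≤ j ≤ r−1. Then ∇det(x) = (λ₁⋯λ_{r−1}) c_r, and for every ω ∈ Ω one has ⟨ω | ∇det(x)⟩ ≠ 0 with sign equal to the sign of λ₁⋯λ_{r−1}; consequently the tangent vectors at x of all C¹ causal curves starting at x lie in one and the same open half-space of J bounded by the tangent hyperplane to J₁ = {y ∈ J : rank(y) = r−1} at x. -/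
open scoped BigOperators Classical

/-- Bare data of a (real) Jordan algebra: a bilinear product and a unit element. -/
structure JordanData (J : Type) [AddCommGroup J] [Module ℝ J] where
  mul : J →ₗ[ℝ] J →ₗ[ℝ] J
  e : J

namespace JordanData

variable {J : Type} [AddCommGroup J] [Module ℝ J] (A : JordanData J)

/-- `c` is an idempotent. -/
def IsIdem (c : J) : Prop := A.mul c c = c

/-- `c` is a primitive idempotent: a nonzero idempotent which dominates only `0` and itself. -/
def IsPrimitive (c : J) : Prop :=
  A.IsIdem c ∧ c ≠ 0 ∧ ∀ d : J, A.IsIdem d → A.mul c d = d → d = 0 ∨ d = c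

/-- A Jordan frame: a complete system of pairwise orthogonal primitive idempotents. -/
def IsFrame {m : ℕ} (c : Fin m → J) : Prop :=
  (∀ j, A.IsPrimitive (c j)) ∧ (∀ i j, i ≠ j → A.mul (c i) (c j) = 0) ∧ ∑ j, c j = A.e

end JordanData

/-- A simple Euclidean Jordan algebra of rank `rank`, together with its trace `tr`
and determinant `jdet` (characterized by their values on spectral decompositions). -/
structure EJA (J : Type) [NormedAddCommGroup J] [NormedSpace ℝ J] [FiniteDimensional ℝ J]
    extends JordanData J where
  comm : ∀ x y : J, mul x y = mul y x
  unit_mul : ∀ x : J, mul e x = x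
  jordan : ∀ x y : J, mul (mul x x) (mul x y) = mul x (mul (mul x x) y)
  tr : J →ₗ[ℝ] ℝ
  tr_posdef : ∀ x : J, x ≠ 0 → 0 < tr (mul x x)
  simple : ∀ I : Submodule ℝ J, (∀ x ∈ I, ∀ y : J, mul y x ∈ I) → I = ⊥ ∨ I = ⊤
  rank : ℕ
  spectral : ∀ x : J, ∃ (c : Fin rank → J) (lam : Fin rank → ℝ),
    toJordanData.IsFrame c ∧ x = ∑ j, lam j • c j
  tr_prim : ∀ c : J, toJordanData.IsPrimitive c → tr c = 1
  jdet : J → ℝ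
  jdet_frame : ∀ (c : Fin rank → J) (lam : Fin rank → ℝ),
    toJordanData.IsFrame c → jdet (∑ j, lam j • c j) = ∏ j, lam j

namespace EJA

variable {J : Type} [NormedAddCommGroup J] [NormedSpace ℝ J] [FiniteDimensional ℝ J]

def IsIdem (A : EJA J) (c : J) : Prop := A.toJordanData.IsIdem c

def IsPrimitive (A : EJA J) (c : J) : Prop := A.toJordanData.IsPrimitive c

def IsFrame (A : EJA J) {m : ℕ} (c : Fin m → J) : Prop := A.toJordanData.IsFrame c

/-- `x` has rank `k`: in a spectral decomposition of `x`, exactly `k` eigenvalues are nonzero. -/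
def HasRank (A : EJA J) (x : J) (k : ℕ) : Prop :=
  ∃ (c : Fin A.rank → J) (lam : Fin A.rank → ℝ), A.IsFrame c ∧
    x = ∑ j, lam j • c j ∧ (Finset.univ.filter fun j => lam j ≠ 0).card = k

/-- The symmetric cone `Ω`: the interior of the set of squares. -/
def cone (A : EJA J) : Set J := interior {x : J | ∃ y : J, x = A.mul y y}

/-- The Peirce space `J(c,t)`, i.e. the `t`-eigenspace of the multiplication operator `L(c)`. -/
def peirce (A : EJA J) (c : J) (t : ℝ) : Submodule ℝ J :=
  LinearMap.ker (A.mul c - t • (LinearMap.id : J →ₗ[ℝ] J))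

/-- The symmetric cone of the Jordan subalgebra `J(c,t)` (`t = 1` or `t = 0`):
the relative interior, within `J(c,t)`, of the set of squares of elements of `J(c,t)`. -/
def subCone (A : EJA J) (c : J) (t : ℝ) : Set J :=
  {x : J | x ∈ A.peirce c t ∧ ∃ U : Set J, IsOpen U ∧ x ∈ U ∧
    ∀ y ∈ U, y ∈ A.peirce c t → ∃ w ∈ A.peirce c t, y = A.mul w w}

/-- Powers in the Jordan algebra, with `x ^ 0 = e`. -/
def pow (A : EJA J) (x : J) : ℕ → J
  | 0 => A.e
  | n + 1 => A.mul x (A.pow x n)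

/-- `y` is the Jordan inverse of `x`: `y` lies in the subalgebra `ℝ[x]` and `x·y = e`. -/
def IsInverse (A : EJA J) (x y : J) : Prop :=
  y ∈ Submodule.span ℝ (Set.range (A.pow x)) ∧ A.mul x y = A.e

/-- The set of invertible linear maps preserving the symmetric cone. -/
def conePreserving (A : EJA J) : Set (J →L[ℝ] J)ˣ :=
  {g | (g : J →L[ℝ] J) '' A.cone = A.cone}

theorem one_mem_conePreserving (A : EJA J) : 1 ∈ A.conePreserving := by
  show (↑(1 : (J →L[ℝ] J)ˣ) : J →L[ℝ] J) '' A.cone = A.cone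
  simp

/-- The group `L`: the identity component of the group of linear transformations of `J`
preserving the symmetric cone `Ω`. -/
def Lgroup (A : EJA J) : Set (J →L[ℝ] J)ˣ :=
  {g | ∃ h : g ∈ A.conePreserving,
    (⟨g, h⟩ : A.conePreserving) ∈ connectedComponent ⟨1, A.one_mem_conePreserving⟩}

end EJA

namespace EJA

variable {J : Type} [NormedAddCommGroup J] [NormedSpace ℝ J] [FiniteDimensional ℝ J]

/-- First linearization of the Jordan identity. -/
theorem jordan_lin (A : EJA J) (x z y : J) :
    (2 : ℝ) • A.mul (A.mul x z) (A.mul x y) + A.mul (A.mul x x) (A.mul z y)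
      = (2 : ℝ) • A.mul x (A.mul (A.mul x z) y) + A.mul z (A.mul (A.mul x x) y) := by
  have h1 := A.jordan (x + z) y
  have h2 := A.jordan (x - z) y
  have h3 := A.jordan z y
  have hc := A.comm z x
  simp only [map_add, map_sub, LinearMap.add_apply, LinearMap.sub_apply, hc] at h1 h2
  linear_combination (norm := module) (1/2 : ℝ) • h1 - (1/2 : ℝ) • h2 - h3

/-- Full linearization of the Jordan identity. -/
theorem jordan_lin2 (A : EJA J) (x z w y : J) :
    A.mul (A.mul x z) (A.mul w y) + A.mul (A.mul w z) (A.mul x y)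
        + A.mul (A.mul x w) (A.mul z y)
      = A.mul x (A.mul (A.mul w z) y) + A.mul w (A.mul (A.mul x z) y)
        + A.mul z (A.mul (A.mul x w) y) := by
  have h1 := A.jordan_lin (x + w) z y
  have h2 := A.jordan_lin x z y
  have h3 := A.jordan_lin w z y
  have hc := A.comm w x
  simp only [map_add, LinearMap.add_apply, hc] at h1
  linear_combination (norm := module) (1/2 : ℝ) • h1 - (1/2 : ℝ) • h2 - (1/2 : ℝ) • h3

/-- The Peirce polynomial. -/
theorem peirce_poly (A : EJA J) {c : J} (hc : A.mul c c = c) (z : J) :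
    A.mul c (A.mul c (A.mul c z))
      = (3/2 : ℝ) • A.mul c (A.mul c z) - (1/2 : ℝ) • A.mul c z := by
  have h := A.jordan_lin c z c
  rw [hc, A.comm (A.mul c z) c, A.comm z c, hc, A.comm z c] at h
  linear_combination (norm := module) (-1/2 : ℝ) • h

theorem peirce_mul (A : EJA J) {c : J} (hc : A.mul c c = c) {a b : J} {α β : ℝ}
    (ha : A.mul c a = α • a) (hb : A.mul c b = β • b) (hα : 1 - 2 * α ≠ 0) :
    A.mul c (A.mul a b) = β • A.mul a b := by
  have h := A.jordan_lin c a b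
  rw [hc, ha, hb] at h
  simp only [map_smul, LinearMap.smul_apply] at h
  have h2 : (1 - 2 * α) • (A.mul c (A.mul a b) - β • A.mul a b) = 0 := by
    linear_combination (norm := module) h
  rcases smul_eq_zero.1 h2 with h3 | h3
  · exact absurd h3 hα
  · exact sub_eq_zero.1 h3

theorem peirce_half_half (A : EJA J) {c : J} (hc : A.mul c c = c) {a b : J}
    (ha : A.mul c a = (1/2 : ℝ) • a) (hb : A.mul c b = (1/2 : ℝ) • b) :
    A.mul c (A.mul c (A.mul a b)) = A.mul c (A.mul a b) := by
  have h := A.jordan_lin2 c a b c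
  rw [hc, A.comm b c, A.comm a c, ha, hb] at h
  simp only [map_smul, LinearMap.smul_apply] at h
  rw [A.comm b a, A.comm a c, ha, A.comm b c, hb, A.comm (A.mul a b) c] at h
  simp only [map_smul, LinearMap.smul_apply] at h
  rw [A.comm b a] at h
  linear_combination (norm := module) -h

theorem peirce_one_zero (A : EJA J) {c : J} (hc : A.mul c c = c) {a b : J}
    (ha : A.mul c a = (1 : ℝ) • a) (hb : A.mul c b = (0 : ℝ) • b) : A.mul a b = 0 := by
  have h1 := A.peirce_mul hc ha hb (by norm_num)
  have h2 := A.peirce_mul hc hb ha (by norm_num)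
  rw [A.comm b a] at h2
  linear_combination (norm := module) h1 - h2

/-- Peirce decomposition. -/
theorem peirce_decomp (A : EJA J) {c : J} (hc : A.mul c c = c) (v : J) :
    ∃ p q n : J, v = p + q + n ∧ A.mul c p = (1 : ℝ) • p ∧ A.mul c q = (1/2 : ℝ) • q ∧
      A.mul c n = (0 : ℝ) • n := by
  have h := A.peirce_poly hc v
  refine ⟨(2 : ℝ) • A.mul c (A.mul c v) - A.mul c v,
    (4 : ℝ) • A.mul c v - (4 : ℝ) • A.mul c (A.mul c v),
    v - (3 : ℝ) • A.mul c v + (2 : ℝ) • A.mul c (A.mul c v), ?_, ?_, ?_, ?_⟩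
  · module
  · simp only [map_sub, map_add, map_smul, h]; module
  · simp only [map_sub, map_add, map_smul, h]; module
  · simp only [map_sub, map_add, map_smul, h]; module

/-- The Peirce reflection. -/
def refl (A : EJA J) (c : J) : J →ₗ[ℝ] J :=
  LinearMap.id - (8 : ℝ) • A.mul c + (8 : ℝ) • (A.mul c ∘ₗ A.mul c)

theorem refl_apply (A : EJA J) (c v : J) :
    A.refl c v = v - (8 : ℝ) • A.mul c v + (8 : ℝ) • A.mul c (A.mul c v) := by
  simp [refl]

theorem refl_fix (A : EJA J) {c v : J} (h : A.mul c (A.mul c v) = A.mul c v) :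
    A.refl c v = v := by
  rw [refl_apply, h]; module

theorem refl_eig (A : EJA J) {c v : J} {α : ℝ} (h : A.mul c v = α • v) :
    A.refl c v = (1 - 8 * α + 8 * α ^ 2) • v := by
  rw [refl_apply, h, map_smul, h]; module

theorem refl_mul (A : EJA J) {c : J} (hc : A.mul c c = c) (a b : J) :
    A.refl c (A.mul a b) = A.mul (A.refl c a) (A.refl c b) := by
  obtain ⟨p, q, n, rfl, hp, hq, hn⟩ := A.peirce_decomp hc a
  obtain ⟨p', q', n', rfl, hp', hq', hn'⟩ := A.peirce_decomp hc b
  have e1 := A.refl_eig (A.peirce_mul hc hp hp' (by norm_num))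
  have e2 := A.refl_eig (A.peirce_mul hc hp hq' (by norm_num))
  have e3 := A.refl_eig (A.peirce_mul hc hp hn' (by norm_num))
  have e4 := A.refl_eig (A.peirce_mul hc hp' hq (by norm_num))
  have e5 := A.refl_fix (A.peirce_half_half hc hq hq')
  have e6 := A.refl_eig (A.peirce_mul hc hn' hq (by norm_num))
  have e7 := A.refl_eig (A.peirce_mul hc hn hp' (by norm_num))
  have e8 := A.refl_eig (A.peirce_mul hc hn hq' (by norm_num))
  have e9 := A.refl_eig (A.peirce_mul hc hn hn' (by norm_num))
  rw [A.comm p' q] at e4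
  rw [A.comm n' q] at e6
  have f1 := A.refl_eig hp
  have f2 := A.refl_eig hq
  have f3 := A.refl_eig hn
  have f4 := A.refl_eig hp'
  have f5 := A.refl_eig hq'
  have f6 := A.refl_eig hn'
  simp only [map_add, LinearMap.add_apply, e1, e2, e3, e4, e5, e6, e7, e8, e9, f1, f2, f3, f4,
    f5, f6, map_smul, LinearMap.smul_apply]
  module

theorem refl_refl (A : EJA J) {c : J} (hc : A.mul c c = c) (a : J) :
    A.refl c (A.refl c a) = a := by
  obtain ⟨p, q, n, rfl, hp, hq, hn⟩ := A.peirce_decomp hc a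
  have f1 := A.refl_eig hp
  have f2 := A.refl_eig hq
  have f3 := A.refl_eig hn
  simp only [map_add, f1, f2, f3, map_smul]
  module

theorem mul_e (A : EJA J) (x : J) : A.mul x A.e = x := by
  rw [A.comm, A.unit_mul]

theorem refl_e (A : EJA J) {c : J} (hc : A.mul c c = c) : A.refl c A.e = A.e := by
  apply A.refl_fix
  rw [A.mul_e, hc]

theorem refl_frame (A : EJA J) {c : J} (hc : A.mul c c = c) {m : ℕ} {d : Fin m → J}
    (hd : A.toJordanData.IsFrame d) : A.toJordanData.IsFrame (fun j => A.refl c (d j)) := by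
  obtain ⟨h1, h2, h3⟩ := hd
  refine ⟨fun j => ⟨?_, ?_, ?_⟩, ?_, ?_⟩
  · have h := (h1 j).1
    unfold JordanData.IsIdem at h ⊢
    rw [← A.refl_mul hc, h]
  · intro h
    replace h : A.refl c (d j) = 0 := h
    apply (h1 j).2.1
    rw [← A.refl_refl hc (d j), h, map_zero]
  · intro f hf hm
    have hf' : A.toJordanData.IsIdem (A.refl c f) := by
      unfold JordanData.IsIdem at hf ⊢
      rw [← A.refl_mul hc, hf]
    have hm' : A.mul (d j) (A.refl c f) = A.refl c f := by
      conv_lhs => rw [← A.refl_refl hc (d j)]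
      rw [← A.refl_mul hc, hm]
    rcases (h1 j).2.2 _ hf' hm' with h | h
    · left; rw [← A.refl_refl hc f, h, map_zero]
    · right; show f = A.refl c (d j); rw [← h, A.refl_refl hc]
  · intro i j hij
    rw [← A.refl_mul hc, h2 i j hij, map_zero]
  · rw [← map_sum, h3, A.refl_e hc]

theorem tr_frame (A : EJA J) {m : ℕ} {d : Fin m → J}
    (hd : A.toJordanData.IsFrame d) (μ : Fin m → ℝ) :
    A.tr (∑ j, μ j • d j) = ∑ j, μ j := by
  simp only [map_sum, map_smul, smul_eq_mul]
  exact Finset.sum_congr rfl fun j _ => by rw [A.tr_prim _ (hd.1 j), mul_one]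

theorem tr_refl (A : EJA J) {c : J} (hc : A.mul c c = c) (v : J) :
    A.tr (A.refl c v) = A.tr v := by
  obtain ⟨d, μ, hd, rfl⟩ := A.spectral v
  rw [A.tr_frame hd, map_sum]
  simp only [map_smul]
  exact A.tr_frame (A.refl_frame hc hd) μ

theorem jdet_refl (A : EJA J) {c : J} (hc : A.mul c c = c) (v : J) :
    A.jdet (A.refl c v) = A.jdet v := by
  obtain ⟨d, μ, hd, rfl⟩ := A.spectral v
  rw [A.jdet_frame d μ hd, map_sum]
  simp only [map_smul]
  exact A.jdet_frame _ μ (A.refl_frame hc hd)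

/-- Multiplication within a frame. -/
theorem frame_mul (A : EJA J) {m : ℕ} {d : Fin m → J}
    (hd : A.toJordanData.IsFrame d) (f g : Fin m → ℝ) :
    A.mul (∑ j, f j • d j) (∑ j, g j • d j) = ∑ j, (f j * g j) • d j := by
  simp only [map_sum, LinearMap.sum_apply, map_smul, LinearMap.smul_apply]
  refine Finset.sum_congr rfl fun j _ => ?_
  rw [Finset.sum_eq_single j]
  · have h : A.mul (d j) (d j) = d j := (hd.1 j).1
    rw [h, smul_smul, mul_comm]
  · intro i _ hij
    rw [hd.2.1 i j hij]; simp
  · simp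

theorem frame_mul_single (A : EJA J) {m : ℕ} {d : Fin m → J}
    (hd : A.toJordanData.IsFrame d) (i : Fin m) (g : Fin m → ℝ) :
    A.mul (d i) (∑ j, g j • d j) = g i • d i := by
  simp only [map_sum, map_smul]
  rw [Finset.sum_eq_single i]
  · have h : A.mul (d i) (d i) = d i := (hd.1 i).1
    rw [h]
  · intro j _ hij
    rw [hd.2.1 i j hij.symm]; simp
  · simp

theorem peirce_one_pow (A : EJA J) {c : J} (hc : A.mul c c = c) {m : ℕ} {d : Fin m → J}
    (hd : A.toJordanData.IsFrame d) (μ : Fin m → ℝ)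
    (hu : A.mul c (∑ j, μ j • d j) = ∑ j, μ j • d j) (p : Polynomial ℝ) :
    A.mul c (∑ j, (μ j * p.eval (μ j)) • d j) = ∑ j, (μ j * p.eval (μ j)) • d j := by
  induction p using Polynomial.induction_on' with
  | add p q hp hq =>
    simp only [Polynomial.eval_add, mul_add, add_smul, Finset.sum_add_distrib, map_add, hp, hq]
  | monomial n a =>
    have key : A.mul c (∑ j, (μ j ^ (n + 1)) • d j) = ∑ j, (μ j ^ (n + 1)) • d j := by
      induction n with
      | zero => simpa using hu
      | succ n ih =>
        have h := A.peirce_mul hc (α := 1) (β := 1) (by rw [hu, one_smul])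
          (by rw [ih, one_smul]) (by norm_num)
        rw [A.frame_mul hd, one_smul] at h
        simpa only [pow_succ' _ (n + 1)] using h
    have h2 : ∑ j, (μ j * (Polynomial.monomial n a).eval (μ j)) • d j
        = a • ∑ j, (μ j ^ (n + 1)) • d j := by
      rw [Finset.smul_sum]
      refine Finset.sum_congr rfl fun j _ => ?_
      rw [Polynomial.eval_monomial, smul_smul]
      congr 1; ring
    rw [h2, map_smul, key]

theorem peirce_one_fun (A : EJA J) {c : J} (hc : A.mul c c = c) {m : ℕ} {d : Fin m → J}
    (hd : A.toJordanData.IsFrame d) (μ : Fin m → ℝ)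
    (hu : A.mul c (∑ j, μ j • d j) = ∑ j, μ j • d j) (f : ℝ → ℝ) (hf : f 0 = 0) :
    A.mul c (∑ j, f (μ j) • d j) = ∑ j, f (μ j) • d j := by
  have h := A.peirce_one_pow hc hd μ hu
    (Lagrange.interpolate (Finset.univ.image μ) id (fun x => f x / x))
  have h2 : ∀ j, μ j * (Lagrange.interpolate (Finset.univ.image μ) id
      (fun x => f x / x)).eval (μ j) = f (μ j) := by
    intro j
    have := Lagrange.eval_interpolate_at_node (s := Finset.univ.image μ) (v := id)
      (fun x => f x / x) (Set.injOn_id _) (Finset.mem_image_of_mem μ (Finset.mem_univ j))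
    rw [id] at this
    rw [this]
    by_cases h0 : μ j = 0
    · rw [h0, hf]; simp
    · field_simp
  simpa only [h2] using h

theorem peirce_one_prim (A : EJA J) {c : J} (hc : A.toJordanData.IsPrimitive c) (u : J)
    (hu : A.mul c u = u) : ∃ s : ℝ, u = s • c := by
  obtain ⟨d, μ, hd, rfl⟩ := A.spectral u
  suffices h : ∑ j, μ j • d j ∈ Submodule.span ℝ {c} by
    obtain ⟨s, hs⟩ := Submodule.mem_span_singleton.1 h
    exact ⟨s, hs.symm⟩
  have key : ∀ a : ℝ, a • ∑ j, (if μ j = a then (1 : ℝ) else 0) • d j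
      ∈ Submodule.span ℝ {c} := by
    intro a
    by_cases ha : a = 0
    · rw [ha, zero_smul]; exact Submodule.zero_mem _
    · apply Submodule.smul_mem
      have h1 := A.peirce_one_fun hc.1 hd μ hu (fun x => if x = a then (1 : ℝ) else 0)
        (if_neg (Ne.symm ha))
      have h2 : A.toJordanData.IsIdem (∑ j, (if μ j = a then (1 : ℝ) else 0) • d j) := by
        unfold JordanData.IsIdem
        rw [A.frame_mul hd]
        refine Finset.sum_congr rfl fun j _ => ?_
        congr 1
        split_ifs <;> simp
      rcases hc.2.2 _ h2 h1 with h | h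
      · rw [h]; exact Submodule.zero_mem _
      · rw [h]; exact Submodule.mem_span_singleton_self c
  have hsum : ∑ j, μ j • d j = ∑ a ∈ Finset.univ.image μ,
      a • ∑ j, (if μ j = a then (1 : ℝ) else 0) • d j := by
    simp only [Finset.smul_sum]
    rw [Finset.sum_comm]
    refine Finset.sum_congr rfl fun j _ => ?_
    rw [Finset.sum_eq_single (μ j)]
    · simp
    · intro b _ hb
      rw [if_neg hb.symm]; simp
    · intro h
      exact absurd (Finset.mem_image_of_mem μ (Finset.mem_univ j)) h
  rw [hsum]
  exact Submodule.sum_mem _ fun a _ => key a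

/-- A linear functional which is invariant under all Peirce reflections of a frame and
vanishes on the frame is zero. -/
theorem functional_zero (A : EJA J) {m : ℕ} {c : Fin m → J}
    (hc : A.toJordanData.IsFrame c) (F : J →ₗ[ℝ] ℝ)
    (hF : ∀ i v, F (A.refl (c i) v) = F v) (hF0 : ∀ i, F (c i) = 0) (v : J) : F v = 0 := by
  have h1 : ∀ i, F (A.mul (c i) v) = 0 := by
    intro i
    have hi : A.mul (c i) (c i) = c i := (hc.1 i).1
    obtain ⟨p, q, n, rfl, hp, hq, hn⟩ := A.peirce_decomp hi v
    rw [one_smul] at hp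
    obtain ⟨s, rfl⟩ := A.peirce_one_prim (hc.1 i) p hp
    have h := hF i q
    rw [A.refl_eig hq, map_smul, smul_eq_mul] at h
    rw [map_add (A.mul (c i)), map_add (A.mul (c i)), hp, hq, hn]
    simp only [map_add, map_smul, hF0, smul_eq_mul]
    linarith
  rw [← A.unit_mul v, ← hc.2.2, map_sum, LinearMap.sum_apply, map_sum]
  exact Finset.sum_eq_zero fun i _ => h1 i

theorem tr_sq_nonneg (A : EJA J) (x : J) : 0 ≤ A.tr (A.mul x x) := by
  by_cases h : x = 0
  · simp [h]
  · exact (A.tr_posdef x h).le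

theorem tr_half (A : EJA J) {c : J} (hc : A.mul c c = c) {q : J}
    (hq : A.mul c q = (1/2 : ℝ) • q) : A.tr q = 0 := by
  have h := A.tr_refl hc q
  rw [A.refl_eig hq, map_smul, smul_eq_mul] at h
  linarith

theorem tr_prim_sq_nonneg (A : EJA J) {c : J} (hc : A.toJordanData.IsPrimitive c) (y : J) :
    0 ≤ A.tr (A.mul c (A.mul y y)) := by
  have hi : A.mul c c = c := hc.1
  obtain ⟨p, q, n, rfl, hp, hq, hn⟩ := A.peirce_decomp hi y
  have e1 := A.peirce_mul hi hp hp (by norm_num)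
  have e2 := A.peirce_mul hi hp hq (by norm_num)
  have e3 := A.peirce_one_zero hi hp hn
  have e4 := A.peirce_mul hi hn hq (by norm_num)
  have e5 := A.peirce_mul hi hn hn (by norm_num)
  have e6 := A.peirce_half_half hi hq hq
  have t2 := A.tr_half hi e2
  have t4 := A.tr_half hi e4
  obtain ⟨s, hs⟩ := A.peirce_one_prim hc _ e6
  have hs0 : 0 ≤ s := by
    by_cases hq0 : q = 0
    · rw [hq0] at hs
      simp only [map_zero] at hs
      rcases smul_eq_zero.1 hs.symm with h | h
      · exact h.ge
      · exact absurd h hc.2.1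
    · have j1 := A.jordan q c
      rw [A.comm q c, hq, A.comm (A.mul q q) c, hs] at j1
      simp only [map_smul] at j1
      rw [A.comm q c, hq] at j1
      have j2 : A.mul (A.mul q q) q = s • q := by
        linear_combination (norm := module) (2 : ℝ) • j1
      have j3 := A.jordan q q
      rw [j2, map_smul] at j3
      have h1 := A.tr_sq_nonneg (A.mul q q)
      have h2 := A.tr_posdef q hq0
      rw [j3, map_smul, smul_eq_mul] at h1
      exact nonneg_of_mul_nonneg_left h1 h2
  have h1 := A.tr_sq_nonneg p
  have e : A.tr (A.mul c (A.mul (p + q + n) (p + q + n))) = A.tr (A.mul p p) + s := by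
    simp only [map_add, LinearMap.add_apply]
    rw [A.comm q p, A.comm n p, A.comm q n, e1, e2, e3, e4, e5, hs]
    simp only [map_add, map_smul, map_zero, smul_eq_mul, t2, t4, A.tr_prim c hc]
    ring
  rw [e]; linarith

theorem tr_prim_cone_pos (A : EJA J) {c : J} (hc : A.toJordanData.IsPrimitive c) {ω : J}
    (hω : ω ∈ A.cone) : 0 < A.tr (A.mul ω c) := by
  have hi : A.mul c c = c := hc.1
  have hn : {x : J | ∃ y : J, x = A.mul y y} ∈ nhds ω := mem_interior_iff_mem_nhds.1 hω
  have ht : Filter.Tendsto (fun t : ℝ => ω - t • c) (nhds 0) (nhds ω) := by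
    have : Continuous (fun t : ℝ => ω - t • c) := by fun_prop
    simpa using this.tendsto 0
  have hev := ht.eventually hn
  obtain ⟨ε, hε, hball⟩ := Metric.eventually_nhds_iff.1 hev
  obtain ⟨y, hy⟩ := @hball (ε / 2) (by
    rw [Real.dist_eq, sub_zero, abs_of_pos (by linarith)]; linarith)
  have h := A.tr_prim_sq_nonneg hc y
  rw [← hy] at h
  simp only [map_sub, map_smul, hi, A.tr_prim c hc, smul_eq_mul] at h
  rw [A.comm]
  linarith

end EJA

/-- Let `x = Σ_{j ≠ i₀} λ_j c_j` have rank `r − 1` (over a Jordan frame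
`(c_j)`, with `λ_{i₀} = 0` and `λ_j ≠ 0` otherwise).  Then
`∇det(x) = (Π_{j ≠ i₀} λ_j) • c_{i₀}`, and for every `ω ∈ Ω` the inner product
`⟨ω | ∇det(x)⟩` is nonzero, with the sign of `Π_{j ≠ i₀} λ_j`.  Consequently the tangent
vectors at `x` of all `C¹` causal curves starting at `x` lie in one and the same open
half-space bounded by the tangent hyperplane to `J₁` at `x`. -/
theorem EJA.grad_jdet_on_corank_one {J : Type} [NormedAddCommGroup J] [NormedSpace ℝ J]
    [FiniteDimensional ℝ J] (A : EJA J) (gdet : J → J)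
    (hgdet : ∀ y : J, HasFDerivAt A.jdet
      (LinearMap.toContinuousLinearMap (A.tr ∘ₗ A.mul (gdet y))) y)
    (c : Fin A.rank → J) (hcf : A.IsFrame c) (lam : Fin A.rank → ℝ) (i0 : Fin A.rank)
    (hlam0 : lam i0 = 0) (hlamne : ∀ j, j ≠ i0 → lam j ≠ 0)
    (x : J) (hx : x = ∑ j, lam j • c j) :
    gdet x = (∏ j ∈ Finset.univ.erase i0, lam j) • c i0 ∧
    (∀ ω ∈ A.cone,
      0 < (∏ j ∈ Finset.univ.erase i0, lam j) * A.tr (A.mul ω (gdet x))) ∧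
    (∀ γ γ' : ℝ → J, (∀ t ∈ Set.Icc (0 : ℝ) 1, HasDerivAt γ (γ' t) t) →
      (∀ t ∈ Set.Icc (0 : ℝ) 1, γ' t ∈ A.cone) → γ 0 = x →
      0 < (∏ j ∈ Finset.univ.erase i0, lam j) * A.tr (A.mul (γ' 0) (gdet x))) := by
  have hfr : A.toJordanData.IsFrame c := hcf
  have hidem : ∀ i, A.mul (c i) (c i) = c i := fun i => (hfr.1 i).1
  have hP : (∏ j ∈ Finset.univ.erase i0, lam j) ≠ 0 :=
    Finset.prod_ne_zero_iff.2 fun j hj => hlamne j (Finset.ne_of_mem_erase hj)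
  have hgrad : gdet x = (∏ j ∈ Finset.univ.erase i0, lam j) • c i0 := by
    -- derivatives along the frame
    have hd : ∀ i, A.tr (A.mul (gdet x) (c i)) = ∏ j ∈ Finset.univ.erase i, lam j := by
      intro i
      have hline : HasDerivAt (fun t : ℝ => x + t • c i) (c i) 0 := by
        have := ((hasDerivAt_id (0 : ℝ)).smul_const (c i)).const_add x
        simpa using this
      have h0 : HasFDerivAt A.jdet
          (LinearMap.toContinuousLinearMap (A.tr ∘ₗ A.mul (gdet x))) (x + (0 : ℝ) • c i) := by
        simpa using hgdet x
      have h1 := h0.comp_hasDerivAt (0 : ℝ) hline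
      have h2 : (A.jdet ∘ fun t : ℝ => x + t • c i)
          = fun t : ℝ => (lam i + t) * ∏ j ∈ Finset.univ.erase i, lam j := by
        funext t
        have e : x + t • c i = ∑ j, (lam j + if j = i then t else 0) • c j := by
          simp [hx, add_smul, Finset.sum_add_distrib, ite_smul]
        show A.jdet (x + t • c i) = _
        rw [e, A.jdet_frame c _ hfr, ← Finset.mul_prod_erase _ _ (Finset.mem_univ i), if_pos rfl]
        congr 1
        refine Finset.prod_congr rfl fun j hj => ?_
        rw [if_neg (Finset.ne_of_mem_erase hj), add_zero]
      have h3 : HasDerivAt (fun t : ℝ => (lam i + t) * ∏ j ∈ Finset.univ.erase i, lam j)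
          (1 * ∏ j ∈ Finset.univ.erase i, lam j) 0 :=
        ((hasDerivAt_id (0 : ℝ)).const_add (lam i)).mul_const _
      rw [h2] at h1
      have h4 := h1.unique h3
      rw [one_mul] at h4
      simpa using h4
    -- invariance of the differential under reflections
    have hinv : ∀ i v, A.tr (A.mul (gdet x) (A.refl (c i) v)) = A.tr (A.mul (gdet x) v) := by
      intro i v
      have hxi : A.refl (c i) x = x := by
        apply A.refl_fix
        rw [hx, A.frame_mul_single hfr, map_smul, hidem]
      have h0 : HasFDerivAt A.jdet
          (LinearMap.toContinuousLinearMap (A.tr ∘ₗ A.mul (gdet x)))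
          (LinearMap.toContinuousLinearMap (A.refl (c i)) x) := by
        simpa [hxi] using hgdet x
      have h1 := h0.comp x (LinearMap.toContinuousLinearMap (A.refl (c i))).hasFDerivAt
      have h2 : (A.jdet ∘ ⇑(LinearMap.toContinuousLinearMap (A.refl (c i)))) = A.jdet := by
        funext w
        exact A.jdet_refl (hidem i) w
      rw [h2] at h1
      have h3 := h1.unique (hgdet x)
      simpa using DFunLike.congr_fun h3 v
    set P := ∏ j ∈ Finset.univ.erase i0, lam j with hPdef
    have key := A.functional_zero hfr (A.tr ∘ₗ A.mul (gdet x - P • c i0)) ?_ ?_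
      (gdet x - P • c i0)
    · by_contra hne
      have := A.tr_posdef _ (sub_ne_zero.2 hne)
      simp only [LinearMap.comp_apply] at key
      linarith
    · intro i v
      have hc0 : A.refl (c i) (c i0) = c i0 := by
        apply A.refl_fix
        by_cases h : i = i0
        · rw [h, hidem, hidem]
        · rw [hfr.2.1 i i0 h, map_zero]
      have h2 : A.tr (A.mul (c i0) (A.refl (c i) v)) = A.tr (A.mul (c i0) v) := by
        conv_lhs => rw [← hc0]
        rw [← A.refl_mul (hidem i), A.tr_refl (hidem i)]
      simp only [LinearMap.comp_apply, map_sub, map_smul, LinearMap.sub_apply,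
        LinearMap.smul_apply, hinv, h2]
    · intro i
      simp only [LinearMap.comp_apply, map_sub, map_smul, LinearMap.sub_apply,
        LinearMap.smul_apply, hd]
      by_cases h : i = i0
      · rw [h, hidem, A.tr_prim _ (hfr.1 i0), smul_eq_mul, mul_one, ← hPdef, sub_self]
      · rw [hfr.2.1 i0 i (Ne.symm h), map_zero, smul_zero, sub_zero]
        exact Finset.prod_eq_zero (Finset.mem_erase.2 ⟨Ne.symm h, Finset.mem_univ _⟩) hlam0
  have hpos : ∀ ω ∈ A.cone,
      0 < (∏ j ∈ Finset.univ.erase i0, lam j) * A.tr (A.mul ω (gdet x)) := by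
    intro ω hω
    have h := A.tr_prim_cone_pos (hfr.1 i0) hω
    rw [hgrad, map_smul, map_smul, smul_eq_mul, ← mul_assoc]
    exact mul_pos (mul_self_pos.2 hP) h
  exact ⟨hgrad, hpos, fun γ γ' _ h2 _ => hpos _ (h2 0 (by simp))⟩
end

section
/- For every z ∈ ℂ ∖ (−∞, 0], the integral ∫_{−∞}^0 ((s − z)⁻¹ − (s − 1)⁻¹) ds converges and equals Log z, the principal determination of the complex logarithm (the branch with Log 1 = 0 and imaginary part in (−π, π)). -/
open MeasureTheory

/-- Shifting a point of the slit plane to the right stays in the slit plane. -/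
theorem sub_mem_slit (z : ℂ) (hz : z ∈ Complex.slitPlane) (s : ℝ) (hs : s ≤ 0) :
    z - (s : ℂ) ∈ Complex.slitPlane := by
  rw [Complex.mem_slitPlane_iff] at hz ⊢
  rcases hz with h | h
  · left
    simp
    linarith
  · right
    simpa using h

theorem resolvent_integrable (z : ℂ) (hz : z ∈ Complex.slitPlane) :
    MeasureTheory.IntegrableOn
      (fun s : ℝ => ((s : ℂ) - z)⁻¹ - ((s : ℂ) - 1)⁻¹) (Set.Iic 0) := by
  have hne : ∀ w ∈ Complex.slitPlane, ∀ s : ℝ, s ≤ 0 → (s : ℂ) - w ≠ 0 := by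
    intro w hw s hs h
    apply Complex.slitPlane_ne_zero (sub_mem_slit w hw s hs)
    rw [← neg_sub, h, neg_zero]
  have hcont : ContinuousOn (fun s : ℝ => ((s : ℂ) - z)⁻¹ - ((s : ℂ) - 1)⁻¹) (Set.Iic 0) := by
    apply ContinuousOn.sub
    · apply ContinuousOn.inv₀ (by fun_prop)
      intro s hs
      exact hne z hz s hs
    · apply ContinuousOn.inv₀ (by fun_prop)
      intro s hs
      exact hne 1 Complex.one_mem_slitPlane s hs
  rw [integrableOn_Iic_iff_integrableAtFilter_atBot]
  have hloc := hcont.locallyIntegrableOn (μ := volume) measurableSet_Iic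
  refine ⟨?_, hloc⟩
  refine ⟨Set.Iic (-2 * ‖z‖ - 1), Filter.Iic_mem_atBot _, ?_⟩
  have hsub : Set.Iic (-2 * ‖z‖ - 1) ⊆ Set.Iic (0 : ℝ) := by
    intro s hs
    have := norm_nonneg z
    simp only [Set.mem_Iic] at *
    linarith
  have hg : IntegrableOn (fun s : ℝ => 4 * ‖z - 1‖ * (1 + s ^ 2)⁻¹)
      (Set.Iic (-2 * ‖z‖ - 1)) :=
    (integrable_inv_one_add_sq.const_mul _).integrableOn
  refine Integrable.mono' hg ((hcont.mono hsub).aestronglyMeasurable measurableSet_Iic) ?_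
  refine (ae_restrict_iff' measurableSet_Iic).2 (Filter.Eventually.of_forall ?_)
  intro s hs
  have hs0 : s ≤ 0 := hsub hs
  have hzn := norm_nonneg z
  simp only [Set.mem_Iic] at hs
  rw [inv_sub_inv (hne z hz s hs0) (hne 1 Complex.one_mem_slitPlane s hs0), norm_div, norm_mul]
  have h0 : ((s : ℂ) - 1) - ((s : ℂ) - z) = z - 1 := by ring
  rw [h0]
  have hns : ‖(s : ℂ)‖ = -s := by
    rw [Complex.norm_real, Real.norm_eq_abs, abs_of_nonpos hs0]
  have h1 : -s / 2 ≤ ‖(s : ℂ) - z‖ := by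
    have := norm_sub_norm_le (s : ℂ) z
    linarith
  have h2 : -s ≤ ‖(s : ℂ) - 1‖ := by
    have : (s : ℂ) - 1 = ((s - 1 : ℝ) : ℂ) := by push_cast; ring
    rw [this, Complex.norm_real, Real.norm_eq_abs, abs_of_nonpos (by linarith)]
    linarith
  have h3 : (-s / 2) * (-s) ≤ ‖(s : ℂ) - z‖ * ‖(s : ℂ) - 1‖ :=
    mul_le_mul h1 h2 (by linarith) (norm_nonneg _)
  have h4 : (1 + s ^ 2) / 4 ≤ ‖(s : ℂ) - z‖ * ‖(s : ℂ) - 1‖ := by nlinarith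
  calc ‖z - 1‖ / (‖(s : ℂ) - z‖ * ‖(s : ℂ) - 1‖) ≤ ‖z - 1‖ / ((1 + s ^ 2) / 4) :=
        div_le_div_of_nonneg_left (norm_nonneg _) (by positivity) h4
    _ = 4 * ‖z - 1‖ * (1 + s ^ 2)⁻¹ := by
        field_simp

theorem hasDerivAt_log_sub (z : ℂ) (hz : z ∈ Complex.slitPlane) (s : ℝ) (hs : s ≤ 0) :
    HasDerivAt (fun s : ℝ => Complex.log (z - (s : ℂ))) (((s : ℂ) - z)⁻¹) s := by
  have h : HasDerivAt (fun s : ℝ => z - (s : ℂ)) (-1) s :=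
    (Complex.ofRealCLM.hasDerivAt (x := s)).const_sub z
  have := h.clog_real (sub_mem_slit z hz s hs)
  convert this using 1
  rw [← neg_sub, inv_neg, neg_div, one_div]

theorem tendsto_log_diff (z : ℂ) (hz : z ∈ Complex.slitPlane) :
    Filter.Tendsto (fun s : ℝ => Complex.log (z - (s : ℂ)) - Complex.log (1 - (s : ℂ)))
      Filter.atBot (nhds 0) := by
  have h1 : Filter.Tendsto (fun s : ℝ => (1 - s)⁻¹) Filter.atBot (nhds 0) := by
    apply Filter.Tendsto.inv_tendsto_atTop
    exact (Filter.tendsto_atTop_add_const_left _ (1 : ℝ)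
      (Filter.tendsto_neg_atBot_atTop (G := ℝ))).congr (fun s => (sub_eq_add_neg 1 s).symm)
  have h2 : Filter.Tendsto (fun s : ℝ => 1 + (z - 1) * (((1 - s)⁻¹ : ℝ) : ℂ))
      Filter.atBot (nhds 1) := by
    have := (((Complex.continuous_ofReal.tendsto 0).comp h1).const_mul (z - 1)).const_add 1
    simpa using this
  have h3 := h2.clog Complex.one_mem_slitPlane
  rw [Complex.log_one] at h3
  refine h3.congr' ?_
  filter_upwards [Filter.Iic_mem_atBot (0 : ℝ)] with s hs
  simp only [Set.mem_Iic] at hs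
  have hpos : 0 < 1 - s := by linarith
  have hne : (1 : ℂ) - s ≠ 0 := by
    exact_mod_cast hpos.ne'
  have e : 1 + (z - 1) * (((1 - s)⁻¹ : ℝ) : ℂ) = (((1 - s)⁻¹ : ℝ) : ℂ) * (z - s) := by
    push_cast
    field_simp
    ring
  rw [e, Complex.log_ofReal_mul (inv_pos.2 hpos)
    (Complex.slitPlane_ne_zero (sub_mem_slit z hz s hs)), Real.log_inv, Complex.ofReal_neg,
    Complex.ofReal_log hpos.le]
  push_cast
  ring

/-- For every `z ∈ ℂ ∖ (−∞, 0]` (the slit plane), the integral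
`∫_{−∞}^0 ((s − z)⁻¹ − (s − 1)⁻¹) ds` converges and equals `Log z`, the principal
determination of the complex logarithm. -/
theorem integral_resolvent_eq_log (z : ℂ) (hz : z ∈ Complex.slitPlane) :
    MeasureTheory.IntegrableOn
      (fun s : ℝ => ((s : ℂ) - z)⁻¹ - ((s : ℂ) - 1)⁻¹) (Set.Iic 0) ∧
    ∫ s in Set.Iic (0 : ℝ), (((s : ℂ) - z)⁻¹ - ((s : ℂ) - 1)⁻¹) = Complex.log z := by
  refine ⟨resolvent_integrable z hz, ?_⟩
  have hd : ∀ s ∈ Set.Iic (0 : ℝ), HasDerivAt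
      (fun s : ℝ => Complex.log (z - (s : ℂ)) - Complex.log (1 - (s : ℂ)))
      (((s : ℂ) - z)⁻¹ - ((s : ℂ) - 1)⁻¹) s := fun s hs =>
    (hasDerivAt_log_sub z hz s hs).sub (hasDerivAt_log_sub 1 Complex.one_mem_slitPlane s hs)
  rw [integral_Iic_of_hasDerivAt_of_tendsto' hd (resolvent_integrable z hz)
    (tendsto_log_diff z hz)]
  simp
end
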